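/- arXiv:2409.03461 — 5 statements merged into one kernel-verified Lean document; each statement's English description precedes it below -/
import Mathlib

section
/- Let D : ℝ^m × ℝ^m → ℝ be such that for every b ∈ ℝ^m the map z ↦ D(z, b) is strictly convex and differentiable, let f : ℝ^n → ℝ ∪ {+∞} be convex piecewise linear with the affine hull of dom(f) = {x | f(x) < +∞} equal to all of ℝ^n, and let A ∈ ℝ^{m×n}. If there exists b ∈ ℝ^m such that S(b) contains two distinct points, then there exists z ∈ ℝ^n with f(z) < +∞ such that row(A) ∩ ∂f(z) ≠ ∅ and n − dim(∂f(z)) > rank(A). -/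
noncomputable section

/-- A polyhedral set: a finite intersection of closed halfspaces. -/
def IsPolyhedron {n : ℕ} (P : Set (Fin n → ℝ)) : Prop :=
  ∃ (k : ℕ) (a : Fin k → (Fin n → ℝ)) (β : Fin k → ℝ),
    P = {x | ∀ i, ∑ j, a i j * x j ≤ β i}

/-- Convex piecewise linear function with values in ℝ ∪ {+∞}: the maximum of finitely
many (at least one) affine functions on a polyhedral set `P`, and `+∞` outside `P`. -/
def IsCPWL {n : ℕ} (f : (Fin n → ℝ) → EReal) : Prop :=
  ∃ (k : ℕ) (v : Fin (k + 1) → (Fin n → ℝ)) (w : Fin (k + 1) → ℝ) (P : Set (Fin n → ℝ)),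
    IsPolyhedron P ∧
    (∀ x ∈ P, f x =
      (((Finset.univ.sup' Finset.univ_nonempty fun i => ∑ j, v i j * x j + w i : ℝ)) : EReal)) ∧
    (∀ x ∉ P, f x = ⊤)

/-- The subdifferential of `f` at `x`:
`{v | f y ≥ f x + ⟨v, y - x⟩ for all y}`, read in ℝ ∪ {+∞}. -/
def subdiff {n : ℕ} (f : (Fin n → ℝ) → EReal) (x : Fin n → ℝ) : Set (Fin n → ℝ) :=
  {v | ∀ y, f x + ((∑ j, v j * (y j - x j) : ℝ) : EReal) ≤ f y}

/-- Dimension of a set: the dimension of the linear span of differences of its elements. -/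
def setDim {n : ℕ} (S : Set (Fin n → ℝ)) : ℕ :=
  Module.finrank ℝ (Submodule.span ℝ {d : Fin n → ℝ | ∃ s ∈ S, ∃ s' ∈ S, d = s - s'})

/-- Row space of a matrix: the range of `Aᵀ`. -/
def rowSpace {m n : ℕ} (A : Matrix (Fin m) (Fin n) ℝ) : Set (Fin n → ℝ) :=
  {v | ∃ z : Fin m → ℝ, v = Matrix.vecMul z A}

/-- Nullity of a matrix: the dimension of its kernel. -/
def nullity {m n : ℕ} (A : Matrix (Fin m) (Fin n) ℝ) : ℕ :=
  Module.finrank ℝ (LinearMap.ker A.mulVecLin)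

/-- Solution set `S(b) = argmin_x D(Ax, b) + f(x)` of the regularized regression problem. -/
def solSet {m n : ℕ} (D : (Fin m → ℝ) → (Fin m → ℝ) → ℝ) (A : Matrix (Fin m) (Fin n) ℝ)
    (f : (Fin n → ℝ) → EReal) (b : Fin m → ℝ) : Set (Fin n → ℝ) :=
  {x | ∀ y, ((D (A.mulVec x) b : ℝ) : EReal) + f x ≤ ((D (A.mulVec y) b : ℝ) : EReal) + f y}

/-- The least squares data fidelity `(1/2)‖z - b‖₂²`. -/
def lsq {m : ℕ} (z b : Fin m → ℝ) : ℝ := (1 / 2) * ∑ i, (z i - b i) ^ 2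

/-- Smooth data fidelity: `z ↦ D(z, b)` is strictly convex and differentiable for each `b`,
with gradient (in the first argument) `g z b`, and `b ↦ g z b = ∇_z D(z, b)` is a bijection
of `ℝ^m` for each `z`. -/
def IsSmoothDataFidelity {m : ℕ} (D : (Fin m → ℝ) → (Fin m → ℝ) → ℝ)
    (g : (Fin m → ℝ) → (Fin m → ℝ) → (Fin m → ℝ)) : Prop :=
  (∀ b, StrictConvexOn ℝ Set.univ fun z => D z b) ∧
  (∀ b, Differentiable ℝ fun z => D z b) ∧
  (∀ z b v, fderiv ℝ (fun z' => D z' b) z v = ∑ i, g z b i * v i) ∧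
  (∀ z, Function.Bijective fun b => g z b)

section MaxAffine

open Filter Topology

variable {n : ℕ} {ι κ : Type*} [Fintype ι] [Nonempty ι]

/-- The maximum of the affine functions `x ↦ v i ⬝ᵥ x + w i`. -/
def maxAffine (v : ι → Fin n → ℝ) (w : ι → ℝ) (x : Fin n → ℝ) : ℝ :=
  Finset.univ.sup' Finset.univ_nonempty fun i => v i ⬝ᵥ x + w i

variable (v : ι → Fin n → ℝ) (w : ι → ℝ) (a : κ → Fin n → ℝ) (β : κ → ℝ)

lemma le_maxAffine (i : ι) (x : Fin n → ℝ) : v i ⬝ᵥ x + w i ≤ maxAffine v w x :=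
  Finset.le_sup' (fun i => v i ⬝ᵥ x + w i) (Finset.mem_univ i)

lemma exists_eq_maxAffine (x : Fin n → ℝ) : ∃ i, v i ⬝ᵥ x + w i = maxAffine v w x := by
  obtain ⟨i, -, hi⟩ := Finset.exists_mem_eq_sup' Finset.univ_nonempty fun i => v i ⬝ᵥ x + w i
  exact ⟨i, hi.symm⟩

lemma maxAffine_segment_le (x y : Fin n → ℝ) {t : ℝ} (h₀ : 0 ≤ t) (h₁ : t ≤ 1) :
    maxAffine v w (x + t • (y - x)) ≤
      maxAffine v w x + t * (maxAffine v w y - maxAffine v w x) := by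
  obtain ⟨i, hi⟩ := exists_eq_maxAffine v w (x + t • (y - x))
  have hx := le_maxAffine v w i x
  have hy := le_maxAffine v w i y
  rw [← hi, dotProduct_add, dotProduct_smul, dotProduct_sub, smul_eq_mul]
  nlinarith

/-- The directions along which no constraint active at `z` changes and all affine pieces
active at `z` have the same slope. -/
def flatDirections (z : Fin n → ℝ) : Submodule ℝ (Fin n → ℝ) where
  carrier := {p | (∀ j, a j ⬝ᵥ z = β j → a j ⬝ᵥ p = 0) ∧
    ∀ i i', v i ⬝ᵥ z + w i = maxAffine v w z → v i' ⬝ᵥ z + w i' = maxAffine v w z →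
      v i ⬝ᵥ p = v i' ⬝ᵥ p}
  zero_mem' := by simp
  add_mem' := by
    rintro p q ⟨hp, hp'⟩ ⟨hq, hq'⟩
    refine ⟨fun j hj => by rw [dotProduct_add, hp j hj, hq j hj, add_zero], fun i i' hi hi' => ?_⟩
    rw [dotProduct_add, dotProduct_add, hp' i i' hi hi', hq' i i' hi hi']
  smul_mem' := by
    rintro c p ⟨hp, hp'⟩
    refine ⟨fun j hj => by rw [dotProduct_smul, hp j hj, smul_zero], fun i i' hi hi' => ?_⟩
    rw [dotProduct_smul, dotProduct_smul, hp' i i' hi hi']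

/-- `u` is bounded by the directional derivative at `z` of the maximum of affine functions
on the polyhedron `{x | ∀ j, a j ⬝ᵥ x ≤ β j}`. -/
def IsLocalSubgradient (z u : Fin n → ℝ) : Prop :=
  ∀ p, (∀ j, a j ⬝ᵥ z = β j → a j ⬝ᵥ p ≤ 0) →
    ∃ i, v i ⬝ᵥ z + w i = maxAffine v w z ∧ u ⬝ᵥ p ≤ v i ⬝ᵥ p

variable {v w a β}

lemma IsLocalSubgradient.dotProduct_eq {z u c : Fin n → ℝ} (hu : IsLocalSubgradient v w a β z u)
    (hc : c ∈ flatDirections v w a β z) {i : ι} (hi : v i ⬝ᵥ z + w i = maxAffine v w z) :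
    u ⬝ᵥ c = v i ⬝ᵥ c := by
  obtain ⟨i₁, hi₁, h₁⟩ := hu c fun j hj => (hc.1 j hj).le
  obtain ⟨i₂, hi₂, h₂⟩ := hu (-c) fun j hj => by rw [dotProduct_neg, hc.1 j hj, neg_zero]
  rw [dotProduct_neg, dotProduct_neg] at h₂
  have e₁ := hc.2 i i₁ hi hi₁
  have e₂ := hc.2 i i₂ hi hi₂
  linarith

/-- Moving a subgradient along `r` one reaches a subgradient exposed by a non-flat feasible
direction. -/
lemma exists_exposing_direction {z u r : Fin n → ℝ} (hu : IsLocalSubgradient v w a β z u)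
    (hr : ∀ c ∈ flatDirections v w a β z, r ⬝ᵥ c = 0)
    (hne : ∃ p, (∀ j, a j ⬝ᵥ z = β j → a j ⬝ᵥ p ≤ 0) ∧ r ⬝ᵥ p ≠ 0) :
    ∃ (t : ℝ) (p : Fin n → ℝ), IsLocalSubgradient v w a β z (u + t • r) ∧
      (∀ j, a j ⬝ᵥ z = β j → a j ⬝ᵥ p ≤ 0) ∧ p ∉ flatDirections v w a β z ∧
      ∀ i, v i ⬝ᵥ z + w i = maxAffine v w z → v i ⬝ᵥ p ≤ (u + t • r) ⬝ᵥ p := by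
  by_contra! hcon
  set S : Set ℝ := {t | IsLocalSubgradient v w a β z (u + t • r)} with hS
  have hclosed : IsClosed S := by
    have : S = ⋂ p ∈ {p | ∀ j, a j ⬝ᵥ z = β j → a j ⬝ᵥ p ≤ 0},
        ⋃ i ∈ {i | v i ⬝ᵥ z + w i = maxAffine v w z},
          {t : ℝ | u ⬝ᵥ p + t * r ⬝ᵥ p ≤ v i ⬝ᵥ p} := by
      ext t
      simp [hS, IsLocalSubgradient, add_dotProduct, smul_dotProduct]
    rw [this]
    refine isClosed_biInter fun p _ => (Set.toFinite _).isClosed_biUnion fun i _ => ?_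
    exact isClosed_le (by fun_prop) continuous_const
  have hopen : IsOpen S := by
    refine isOpen_iff_mem_nhds.2 fun t ht => ?_
    obtain ⟨W, hW⟩ := (flatDirections v w a β z).exists_isCompl
    set K : Set (Fin n → ℝ) :=
      Metric.sphere 0 1 ∩ (W ∩ {p | ∀ j, a j ⬝ᵥ z = β j → a j ⬝ᵥ p ≤ 0}) with hK
    have hKc : IsCompact K := by
      refine (isCompact_sphere 0 1).inter_right (W.closed_of_finiteDimensional.inter ?_)
      simp only [Set.ofPred_forall]
      refine isClosed_iInter fun j => isClosed_iInter fun _ => ?_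
      exact isClosed_le (Continuous.dotProduct continuous_const continuous_id) continuous_const
    have hev : ∀ᶠ s in 𝓝 t, ∀ p ∈ K, ∃ i, v i ⬝ᵥ z + w i = maxAffine v w z ∧
        (u + s • r) ⬝ᵥ p < v i ⬝ᵥ p := by
      refine hKc.eventually_forall_of_forall_eventually fun p hp => ?_
      have hpC : p ∉ flatDirections v w a β z := fun h => by
        have h0 : p = 0 := (Submodule.disjoint_def.1 hW.disjoint) p h hp.2.1
        simpa [h0] using hp.1
      obtain ⟨i, hi, hlt⟩ := hcon t p ht hp.2.2 hpC
      have hcont₁ : Continuous fun q : ℝ × (Fin n → ℝ) => (u + q.1 • r) ⬝ᵥ q.2 :=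
        Continuous.dotProduct (by fun_prop) continuous_snd
      have hcont₂ : Continuous fun q : ℝ × (Fin n → ℝ) => v i ⬝ᵥ q.2 :=
        Continuous.dotProduct continuous_const continuous_snd
      filter_upwards [hcont₁.continuousAt.eventually_lt hcont₂.continuousAt hlt] with q hq
      exact ⟨i, hi, hq⟩
    filter_upwards [hev] with s hs p hp
    obtain ⟨c, hc, q, hq, rfl⟩ : ∃ c ∈ flatDirections v w a β z, ∃ q ∈ W, c + q = p :=
      Submodule.mem_sup.1 (hW.sup_eq_top ▸ Submodule.mem_top)
    have hflat : ∀ i, v i ⬝ᵥ z + w i = maxAffine v w z → (u + s • r) ⬝ᵥ c = v i ⬝ᵥ c :=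
      fun i hi => by
        rw [add_dotProduct, smul_dotProduct, hr c hc, smul_zero, add_zero,
          hu.dotProduct_eq hc hi]
    by_cases hq0 : q = 0
    · obtain ⟨i, hi⟩ := exists_eq_maxAffine v w z
      refine ⟨i, hi, ?_⟩
      rw [hq0, add_zero, hflat i hi]
    · have hqn : 0 < ‖q‖ := norm_pos_iff.2 hq0
      obtain ⟨i, hi, hlt⟩ := hs (‖q‖⁻¹ • q) ⟨by simp [norm_smul, hqn.ne'],
        W.smul_mem _ hq, fun j hj => by
          have := hp j hj
          rw [dotProduct_add, hc.1 j hj, zero_add] at this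
          rw [dotProduct_smul, smul_eq_mul]
          exact mul_nonpos_of_nonneg_of_nonpos (by positivity) this⟩
      refine ⟨i, hi, ?_⟩
      rw [dotProduct_smul, dotProduct_smul, smul_eq_mul, smul_eq_mul] at hlt
      have := lt_of_mul_lt_mul_left hlt (by positivity)
      rw [dotProduct_add, dotProduct_add, hflat i hi]
      linarith
  have huniv : S = Set.univ :=
    IsClopen.eq_univ ⟨hclosed, hopen⟩ ⟨0, by simpa [hS] using hu⟩
  obtain ⟨p, hp, hrp⟩ := hne
  obtain ⟨B, hB⟩ : ∃ B, ∀ i, v i ⬝ᵥ p ≤ B :=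
    (Set.finite_range fun i => v i ⬝ᵥ p).bddAbove.imp fun B hB i => hB ⟨i, rfl⟩
  have hmem : (B - u ⬝ᵥ p + 1) / r ⬝ᵥ p ∈ S := huniv ▸ Set.mem_univ _
  obtain ⟨i, -, hi⟩ := hmem p hp
  rw [add_dotProduct, smul_dotProduct, smul_eq_mul, div_mul_cancel₀ _ hrp] at hi
  linarith [hB i]

variable [Finite κ]

lemma exists_small_step {z p : Fin n → ℝ} (hz : ∀ j, a j ⬝ᵥ z ≤ β j)
    (hp : ∀ j, a j ⬝ᵥ z = β j → a j ⬝ᵥ p ≤ 0) :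
    ∃ ε : ℝ, 0 < ε ∧ (∀ j, a j ⬝ᵥ (z + ε • p) ≤ β j) ∧
      (∀ j, a j ⬝ᵥ (z + ε • p) = β j → a j ⬝ᵥ z = β j ∧ a j ⬝ᵥ p = 0) ∧
      ∀ i, v i ⬝ᵥ (z + ε • p) + w i = maxAffine v w (z + ε • p) →
        v i ⬝ᵥ z + w i = maxAffine v w z := by
  have hlim : ∀ c : Fin n → ℝ,
      Tendsto (fun ε : ℝ => c ⬝ᵥ z + ε * c ⬝ᵥ p) (𝓝[>] 0) (𝓝 (c ⬝ᵥ z)) := by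
    intro c
    have : Continuous fun ε : ℝ => c ⬝ᵥ z + ε * c ⬝ᵥ p := by fun_prop
    simpa using (this.tendsto 0).mono_left nhdsWithin_le_nhds
  have hpos : ∀ᶠ ε : ℝ in 𝓝[>] 0, 0 < ε := self_mem_nhdsWithin
  have hJ : ∀ᶠ ε : ℝ in 𝓝[>] 0, ∀ j, a j ⬝ᵥ z + ε * a j ⬝ᵥ p ≤ β j ∧
      (a j ⬝ᵥ z + ε * a j ⬝ᵥ p = β j → a j ⬝ᵥ z = β j ∧ a j ⬝ᵥ p = 0) := by
    refine eventually_all.2 fun j => ?_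
    by_cases hj : a j ⬝ᵥ z = β j
    · filter_upwards [hpos] with ε hε
      refine ⟨by nlinarith [hp j hj], fun h => ⟨hj, ?_⟩⟩
      have : ε * a j ⬝ᵥ p = 0 := by linarith
      exact (mul_eq_zero.1 this).resolve_left hε.ne'
    · filter_upwards [(hlim (a j)).eventually_lt_const (lt_of_le_of_ne (hz j) hj)] with ε hε
      exact ⟨hε.le, fun h => absurd h hε.ne⟩
  have hI : ∀ᶠ ε : ℝ in 𝓝[>] 0, ∀ i,
      v i ⬝ᵥ (z + ε • p) + w i = maxAffine v w (z + ε • p) →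
        v i ⬝ᵥ z + w i = maxAffine v w z := by
    refine eventually_all.2 fun i => ?_
    by_cases hi : v i ⬝ᵥ z + w i = maxAffine v w z
    · exact Eventually.of_forall fun _ _ => hi
    · obtain ⟨i', hi'⟩ := exists_eq_maxAffine v w z
      have hlt : v i ⬝ᵥ z + w i < v i' ⬝ᵥ z + w i' :=
        hi' ▸ lt_of_le_of_ne (le_maxAffine v w i z) hi
      filter_upwards [((hlim (v i)).add_const (w i)).eventually_lt
        ((hlim (v i')).add_const (w i')) hlt] with ε hε h
      have := le_maxAffine v w i' (z + ε • p)
      rw [← h] at this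
      simp only [dotProduct_add, dotProduct_smul, smul_eq_mul] at this
      linarith
  obtain ⟨ε, hε, hJ, hI⟩ := (hpos.and (hJ.and hI)).exists
  refine ⟨ε, hε, fun j => ?_, fun j => ?_, hI⟩
  · simpa only [dotProduct_add, dotProduct_smul, smul_eq_mul] using (hJ j).1
  · simpa only [dotProduct_add, dotProduct_smul, smul_eq_mul] using (hJ j).2

lemma isLocalSubgradient_iff {z u : Fin n → ℝ} (hz : ∀ j, a j ⬝ᵥ z ≤ β j) :
    IsLocalSubgradient v w a β z u ↔
      ∀ y, (∀ j, a j ⬝ᵥ y ≤ β j) → maxAffine v w z + u ⬝ᵥ (y - z) ≤ maxAffine v w y := by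
  constructor
  · intro h y hy
    obtain ⟨i, hi, hui⟩ := h (y - z) fun j hj => by
      rw [dotProduct_sub, hj]
      linarith [hy j]
    have := le_maxAffine v w i y
    rw [dotProduct_sub (v i)] at hui
    linarith
  · intro h p hp
    obtain ⟨ε, hε, hfeas, -, hact⟩ := exists_small_step (v := v) (w := w) hz hp
    obtain ⟨i, hi⟩ := exists_eq_maxAffine v w (z + ε • p)
    refine ⟨i, hact i hi, ?_⟩
    have h1 := h _ hfeas
    rw [← hi, ← hact i hi, add_sub_cancel_left, dotProduct_add, dotProduct_smul,
      dotProduct_smul, smul_eq_mul, smul_eq_mul] at h1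
    exact le_of_mul_le_mul_left (by linarith) hε

/-- If a row space vector is a subgradient at `z` and the flat directions at `z` contain a
kernel vector, some point has at least `k` flat directions, for every `k ≤ A.rank + 1`. -/
lemma exists_flatDirections_finrank_ge {m : ℕ} (A : Matrix (Fin m) (Fin n) ℝ)
    {d : Fin n → ℝ} (hd : d ≠ 0) (hAd : A.mulVec d = 0)
    (hspan : ∀ r z : Fin n → ℝ, (∀ y, (∀ j, a j ⬝ᵥ y ≤ β j) → r ⬝ᵥ (y - z) = 0) → r = 0)
    {z₀ u₀ : Fin n → ℝ} (hz₀ : ∀ j, a j ⬝ᵥ z₀ ≤ β j) (hu₀ : u₀ ∈ rowSpace A)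
    (hsub₀ : IsLocalSubgradient v w a β z₀ u₀) (hd₀ : d ∈ flatDirections v w a β z₀)
    (k : ℕ) (hk : k ≤ A.rank + 1) :
    ∃ z u : Fin n → ℝ, (∀ j, a j ⬝ᵥ z ≤ β j) ∧ u ∈ rowSpace A ∧
      IsLocalSubgradient v w a β z u ∧ d ∈ flatDirections v w a β z ∧
      k ≤ Module.finrank ℝ (flatDirections v w a β z) := by
  induction k with
  | zero => exact ⟨z₀, u₀, hz₀, hu₀, hsub₀, hd₀, Nat.zero_le _⟩
  | succ k ih =>
    obtain ⟨z, u, hz, ⟨g₀, hg₀⟩, hu, hdz, hkz⟩ := ih (by omega)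
    by_cases hlt : k + 1 ≤ Module.finrank ℝ (flatDirections v w a β z)
    · exact ⟨z, u, hz, ⟨g₀, hg₀⟩, hu, hdz, hlt⟩
    have hCrank : Module.finrank ℝ (flatDirections v w a β z) ≤ A.rank := by omega
    have hmap : Module.finrank ℝ ((flatDirections v w a β z).map A.mulVecLin) < A.rank := by
      refine lt_of_lt_of_le ?_ hCrank
      set φ := A.mulVecLin.domRestrict (flatDirections v w a β z)
      have h1 := φ.finrank_range_add_finrank_ker
      have h2 : 0 < Module.finrank ℝ (LinearMap.ker φ) := by
        have hker : (⟨d, hdz⟩ : flatDirections v w a β z) ∈ LinearMap.ker φ := hAd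
        refine (Module.finrank_pos_iff_exists_ne_zero (R := ℝ)).2
          ⟨(⟨_, hker⟩ : LinearMap.ker φ), fun h => hd ?_⟩
        exact congrArg (fun x => x.1.1) h
      have h3 : LinearMap.range φ = (flatDirections v w a β z).map A.mulVecLin :=
        LinearMap.range_domRestrict _ _
      rw [← h3]
      omega
    obtain ⟨x, hx⟩ : ∃ x, A.mulVecLin x ∉ (flatDirections v w a β z).map A.mulVecLin := by
      by_contra! h
      refine hmap.not_ge (Submodule.finrank_mono ?_)
      rintro _ ⟨x, rfl⟩
      exact h x
    obtain ⟨g, hgx, hg⟩ := Submodule.exists_le_ker_of_notMem hx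
    set γ : Fin m → ℝ := (dotProductEquiv ℝ (Fin m)).symm g with hγ
    have hγg : ∀ q, γ ⬝ᵥ q = g q := fun q =>
      LinearMap.congr_fun ((dotProductEquiv ℝ (Fin m)).apply_symm_apply g) q
    set r := Matrix.vecMul γ A with hrdef
    have hr : ∀ p, r ⬝ᵥ p = g (A.mulVecLin p) := fun p => by
      rw [hrdef, ← Matrix.dotProduct_mulVec, hγg, Matrix.mulVecLin_apply]
    have hr0 : r ≠ 0 := fun h => hgx (by rw [← hr x, h, zero_dotProduct])
    have hrC : ∀ c ∈ flatDirections v w a β z, r ⬝ᵥ c = 0 := fun c hc => by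
      rw [hr]
      exact hg (Submodule.mem_map_of_mem hc)
    have hne : ∃ p, (∀ j, a j ⬝ᵥ z = β j → a j ⬝ᵥ p ≤ 0) ∧ r ⬝ᵥ p ≠ 0 := by
      by_contra! h
      refine hr0 (hspan r z fun y hy => h _ fun j hj => ?_)
      rw [dotProduct_sub, hj]
      linarith [hy j]
    obtain ⟨t, p, ht, hp, hpC, hmax⟩ := exists_exposing_direction hu hrC hne
    obtain ⟨ε, hε, hfeas, hactJ, hactI⟩ := exists_small_step (v := v) (w := w) hz hp
    have hslope : ∀ i, v i ⬝ᵥ (z + ε • p) + w i = maxAffine v w (z + ε • p) →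
        v i ⬝ᵥ p = (u + t • r) ⬝ᵥ p := by
      intro i hi
      refine le_antisymm (hmax i (hactI i hi)) ?_
      have := (isLocalSubgradient_iff hz).1 ht _ hfeas
      rw [← hi, ← hactI i hi, add_sub_cancel_left, dotProduct_smul, dotProduct_add (v i),
        dotProduct_smul, smul_eq_mul, smul_eq_mul] at this
      exact le_of_mul_le_mul_left (by linarith) hε
    have hle : flatDirections v w a β z ≤ flatDirections v w a β (z + ε • p) := fun c hc =>
      ⟨fun j hj => hc.1 j (hactJ j hj).1, fun i i' hi hi' => hc.2 i i' (hactI i hi) (hactI i' hi')⟩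
    have hpmem : p ∈ flatDirections v w a β (z + ε • p) :=
      ⟨fun j hj => (hactJ j hj).2, fun i i' hi hi' => (hslope i hi).trans (hslope i' hi').symm⟩
    refine ⟨z + ε • p, u + t • r, hfeas, ⟨g₀ + t • γ, ?_⟩, ?_, hle hdz, ?_⟩
    · rw [Matrix.add_vecMul, Matrix.smul_vecMul, ← hg₀]
    · refine (isLocalSubgradient_iff hfeas).2 fun y hy => ?_
      have h1 := (isLocalSubgradient_iff hz).1 ht y hy
      obtain ⟨i, hi⟩ := exists_eq_maxAffine v w (z + ε • p)
      have h2 := hactI i hi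
      rw [← sub_sub, dotProduct_sub _ (y - z), dotProduct_smul, ← hslope i hi, ← hi,
        dotProduct_add (v i), dotProduct_smul, smul_eq_mul]
      linarith
    · have := Submodule.finrank_lt_finrank_of_lt
        (lt_of_le_of_ne hle fun h => hpC (h ▸ hpmem))
      omega

end MaxAffine

lemma setDim_add_finrank_le {n : ℕ} {S : Set (Fin n → ℝ)} {C : Submodule ℝ (Fin n → ℝ)}
    (h : ∀ s ∈ S, ∀ s' ∈ S, ∀ c ∈ C, s ⬝ᵥ c = s' ⬝ᵥ c) :
    setDim S + Module.finrank ℝ C ≤ n := by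
  have horth : ∀ e ∈ Submodule.span ℝ {d : Fin n → ℝ | ∃ s ∈ S, ∃ s' ∈ S, d = s - s'},
      ∀ c ∈ C, e ⬝ᵥ c = 0 := by
    intro e he c hc
    induction he using Submodule.span_induction with
    | mem x hx =>
      obtain ⟨s, hs, s', hs', rfl⟩ := hx
      rw [sub_dotProduct, h s hs s' hs' c hc, sub_self]
    | zero => exact zero_dotProduct c
    | add x y _ _ hx hy => rw [add_dotProduct, hx, hy, add_zero]
    | smul t x _ hx => rw [smul_dotProduct, hx, smul_zero]
  have hdisj : Disjoint
      (Submodule.span ℝ {d : Fin n → ℝ | ∃ s ∈ S, ∃ s' ∈ S, d = s - s'}) C :=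
    Submodule.disjoint_def.2 fun e he hc => dotProduct_self_eq_zero.1 (horth e he e hc)
  simpa [setDim] using Submodule.finrank_add_finrank_le_of_disjoint hdisj

lemma eq_zero_of_affineSpan_eq_top {n : ℕ} {P : Set (Fin n → ℝ)} (hP : affineSpan ℝ P = ⊤)
    {r z : Fin n → ℝ} (h : ∀ y ∈ P, r ⬝ᵥ (y - z) = 0) : r = 0 := by
  have hr : r ∈ vectorSpan ℝ P := by
    rw [← direction_affineSpan, hP, AffineSubspace.direction_top]
    trivial
  have key : ∀ e ∈ vectorSpan ℝ P, r ⬝ᵥ e = 0 := by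
    intro e he
    induction he using Submodule.span_induction with
    | mem x hx =>
      obtain ⟨s, hs, s', hs', rfl⟩ := Set.mem_vsub.1 hx
      have h1 := h s hs
      have h2 := h s' hs'
      rw [vsub_eq_sub, dotProduct_sub]
      rw [dotProduct_sub] at h1 h2
      linarith
    | zero => exact dotProduct_zero r
    | add x y _ _ hx hy => rw [dotProduct_add, hx, hy, add_zero]
    | smul t x _ hx => rw [dotProduct_smul, hx, smul_zero]
  exact dotProduct_self_eq_zero.1 (key r hr)

/-- First-order optimality along a segment. -/
lemma neg_fderiv_le_of_forall_le {E : Type*} [NormedAddCommGroup E] [NormedSpace ℝ E]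
    {G : E → ℝ} {c q : E} (hG : DifferentiableAt ℝ G c) {s : ℝ}
    (h : ∀ t : ℝ, 0 < t → t ≤ 1 → G c ≤ G (c + t • q) + t * s) : -fderiv ℝ G c q ≤ s := by
  have hlim := hG.hasFDerivAt.hasLineDerivAt q
  have hlim' := hlim.tendsto_slope_zero_right
  have : -s ≤ fderiv ℝ G c q := by
    refine ge_of_tendsto hlim' ?_
    filter_upwards [Ioc_mem_nhdsGT (zero_lt_one' ℝ)] with t ht
    have := h t ht.1 ht.2
    rw [smul_eq_mul, le_inv_mul_iff₀ ht.1]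
    linarith
  linarith

/-- Sufficient condition for uniqueness (contrapositive form): non-uniqueness for some
data produces an accessible subdifferential of codimension exceeding the rank of `A`. -/
theorem suf_condition_uniqueness {n m : ℕ} (D : (Fin m → ℝ) → (Fin m → ℝ) → ℝ)
    (hDconv : ∀ b : Fin m → ℝ, StrictConvexOn ℝ Set.univ fun z => D z b)
    (hDdiff : ∀ b : Fin m → ℝ, Differentiable ℝ fun z => D z b)
    (f : (Fin n → ℝ) → EReal) (hf : IsCPWL f)
    (hdom : affineSpan ℝ {x : Fin n → ℝ | f x < ⊤} = ⊤)
    (A : Matrix (Fin m) (Fin n) ℝ) (b : Fin m → ℝ) (x y : Fin n → ℝ) (hxy : x ≠ y)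
    (hx : x ∈ solSet D A f b) (hy : y ∈ solSet D A f b) :
    ∃ z : Fin n → ℝ, f z < ⊤ ∧ (rowSpace A ∩ subdiff f z).Nonempty ∧
      A.rank < n - setDim (subdiff f z) := by
  obtain ⟨k, v, w, P, ⟨l, a, β, rfl⟩, hfP, hfnP⟩ := hf
  replace hfP : ∀ x, (∀ j, a j ⬝ᵥ x ≤ β j) → f x = (maxAffine v w x : EReal) := hfP
  replace hfnP : ∀ x, (¬ ∀ j, a j ⬝ᵥ x ≤ β j) → f x = ⊤ := hfnP
  have hlt : ∀ x, f x < ⊤ ↔ ∀ j, a j ⬝ᵥ x ≤ β j := by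
    intro x
    by_cases h : ∀ j, a j ⬝ᵥ x ≤ β j
    · simpa only [hfP x h, h, implies_true, iff_true] using EReal.coe_lt_top _
    · simp only [hfnP x h, h, lt_irrefl]
  have hsubdiff : ∀ z, (∀ j, a j ⬝ᵥ z ≤ β j) → ∀ u,
      u ∈ subdiff f z ↔ IsLocalSubgradient v w a β z u := by
    intro z hz u
    rw [isLocalSubgradient_iff hz]
    change (∀ y, f z + ((u ⬝ᵥ (y - z) : ℝ) : EReal) ≤ f y) ↔ _
    refine forall_congr' fun y => ?_
    by_cases h : ∀ j, a j ⬝ᵥ y ≤ β j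
    · rw [hfP z hz, hfP y h, ← EReal.coe_add, EReal.coe_le_coe_iff]
      exact ⟨fun H _ => H, fun H => H h⟩
    · simp [hfnP y h, h]
  obtain ⟨x₀, hx₀⟩ : {x : Fin n → ℝ | f x < ⊤}.Nonempty := by
    rw [← affineSpan_nonempty ℝ, hdom]
    exact Set.univ_nonempty
  have hmin : ∀ x ∈ solSet D A f b, (∀ j, a j ⬝ᵥ x ≤ β j) ∧
      ∀ q, (∀ j, a j ⬝ᵥ q ≤ β j) →
        D (A.mulVec x) b + maxAffine v w x ≤ D (A.mulVec q) b + maxAffine v w q := by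
    intro x hx
    have hxf : ∀ j, a j ⬝ᵥ x ≤ β j := by
      by_contra h
      have h1 := hx x₀
      rw [hfnP x h, hfP x₀ ((hlt x₀).1 hx₀), EReal.coe_add_top, ← EReal.coe_add] at h1
      exact (EReal.coe_lt_top _).not_ge h1
    refine ⟨hxf, fun q hq => ?_⟩
    have h1 := hx q
    rw [hfP x hxf, hfP q hq] at h1
    exact_mod_cast h1
  obtain ⟨hxf, hxmin⟩ := hmin x hx
  obtain ⟨hyf, hymin⟩ := hmin y hy
  set z := x + (1 / 2 : ℝ) • (y - x) with hz
  have hdotz : ∀ c : Fin n → ℝ, c ⬝ᵥ z = (c ⬝ᵥ x + c ⬝ᵥ y) / 2 := fun c => by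
    rw [hz, dotProduct_add, dotProduct_smul, dotProduct_sub, smul_eq_mul]
    ring
  have hzf : ∀ j, a j ⬝ᵥ z ≤ β j := fun j => by
    rw [hdotz]
    linarith [hxf j, hyf j]
  have hFz := maxAffine_segment_le v w x y (t := 1 / 2) (by norm_num) (by norm_num)
  rw [← hz] at hFz
  have hxy' := hxmin y hyf
  have hyx' := hymin x hxf
  have hxz := hxmin z hzf
  have hAxy : A.mulVec x = A.mulVec y := by
    by_contra hne
    have h1 := (hDconv b).2 (Set.mem_univ (A.mulVec x)) (Set.mem_univ (A.mulVec y)) hne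
      (show (0 : ℝ) < 1 / 2 by norm_num) (show (0 : ℝ) < 1 / 2 by norm_num) (by norm_num)
    have h2 : (1 / 2 : ℝ) • A.mulVec x + (1 / 2 : ℝ) • A.mulVec y = A.mulVec z := by
      rw [hz, Matrix.mulVec_add, Matrix.mulVec_smul, Matrix.mulVec_sub]
      module
    simp only [h2, smul_eq_mul] at h1
    linarith
  have hAz : A.mulVec z = A.mulVec x := by
    rw [hz, Matrix.mulVec_add, Matrix.mulVec_smul, Matrix.mulVec_sub, ← hAxy, sub_self,
      smul_zero, add_zero]
  rw [← hAxy] at hxy' hyx'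
  rw [hAz] at hxz
  have hflat : y - x ∈ flatDirections v w a β z := by
    have hpiece : ∀ i, v i ⬝ᵥ z + w i = maxAffine v w z → v i ⬝ᵥ (y - x) = 0 := by
      intro i hi
      rw [hdotz] at hi
      rw [dotProduct_sub]
      linarith [le_maxAffine v w i x, le_maxAffine v w i y]
    refine ⟨fun j hj => ?_, fun i i' hi hi' => (hpiece i hi).trans (hpiece i' hi').symm⟩
    rw [hdotz] at hj
    rw [dotProduct_sub]
    linarith [hxf j, hyf j]
  set G := fderiv ℝ (fun z => D z b) (A.mulVec z)
  set γ : Fin m → ℝ := (dotProductEquiv ℝ (Fin m)).symm (-G).toLinearMap with hγ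
  have hγG : ∀ q, γ ⬝ᵥ q = -G q := fun q =>
    LinearMap.congr_fun ((dotProductEquiv ℝ (Fin m)).apply_symm_apply (-G).toLinearMap) q
  have hsub : IsLocalSubgradient v w a β z (Matrix.vecMul γ A) := by
    refine (isLocalSubgradient_iff hzf).2 fun q hq => ?_
    rw [← Matrix.dotProduct_mulVec, hγG]
    have := neg_fderiv_le_of_forall_le (hDdiff b (A.mulVec z)) (q := A.mulVec (q - z))
      (s := maxAffine v w q - maxAffine v w z) fun t ht₀ ht₁ => by
        have hfeas : ∀ j, a j ⬝ᵥ (z + t • (q - z)) ≤ β j := fun j => by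
          rw [dotProduct_add, dotProduct_smul, dotProduct_sub, smul_eq_mul]
          nlinarith [hzf j, hq j]
        have h1 := hxmin _ hfeas
        have h2 := maxAffine_segment_le v w z q ht₀.le ht₁
        rw [Matrix.mulVec_add, Matrix.mulVec_smul] at h1
        simp only [hAz] at h1 ⊢
        linarith
    linarith
  obtain ⟨z', u, hz', hu, hsub', -, hrank⟩ := exists_flatDirections_finrank_ge A
    (sub_ne_zero.2 hxy.symm) (by rw [Matrix.mulVec_sub, hAxy, sub_self])
    (fun r z h => eq_zero_of_affineSpan_eq_top hdom fun y hy => h y ((hlt y).1 hy))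
    hzf ⟨γ, rfl⟩ hsub hflat (A.rank + 1) le_rfl
  refine ⟨z', (hlt z').2 hz', ⟨u, hu, (hsubdiff z' hz' u).2 hsub'⟩, ?_⟩
  obtain ⟨i, hi⟩ := exists_eq_maxAffine v w z'
  have := setDim_add_finrank_le (S := subdiff f z') (C := flatDirections v w a β z')
    fun s hs s' hs' c hc => by
      rw [((hsubdiff z' hz' s).1 hs).dotProduct_eq hc hi,
        ((hsubdiff z' hz' s').1 hs').dotProduct_eq hc hi]
  omega

end
end

section
/- Let f : ℝ^n → ℝ ∪ {+∞} be proper (finite at some point), convex (f(tx + (1−t)y) ≤ t f(x) + (1−t) f(y) for all x, y and t ∈ [0,1], in ℝ ∪ {+∞}), and lower semicontinuous, let A ∈ ℝ^{m×n}, and let D : ℝ^m × ℝ^m → ℝ be strictly convex in its first argument (z ↦ D(z, b) is strictly convex for every b). Then for every b ∈ ℝ^m, if x, y ∈ S(b) then Ax = Ay and f(x) = f(y). -/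
noncomputable section

/-- Two solutions for the same data have equal fit and equal regularization value. -/
theorem equal_fit {n m : ℕ} (f : (Fin n → ℝ) → EReal)
    (hproper : ∃ x, f x < ⊤) (hbot : ∀ x, f x ≠ ⊥)
    (hconv : ∀ x y : Fin n → ℝ, ∀ t : ℝ, 0 ≤ t → t ≤ 1 →
      f (t • x + (1 - t) • y) ≤ (t : EReal) * f x + ((1 - t : ℝ) : EReal) * f y)
    (hlsc : LowerSemicontinuous f) (A : Matrix (Fin m) (Fin n) ℝ)
    (D : (Fin m → ℝ) → (Fin m → ℝ) → ℝ)
    (hD : ∀ b : Fin m → ℝ, StrictConvexOn ℝ Set.univ fun z => D z b)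
    (b : Fin m → ℝ) (x y : Fin n → ℝ) (hx : x ∈ solSet D A f b)
    (hy : y ∈ solSet D A f b) :
    A.mulVec x = A.mulVec y ∧ f x = f y := by
  have lt_top {u : Fin n → ℝ} (hu : u ∈ solSet D A f b) : f u ≠ ⊤ := by
    obtain ⟨z, hz⟩ := hproper
    intro h
    have hle := hu z
    rw [h, EReal.coe_add_top, top_le_iff] at hle
    exact (EReal.add_lt_top (EReal.coe_ne_top _) hz.ne).ne hle
  obtain ⟨p, hp⟩ : ∃ p : ℝ, f x = p := ⟨_, (EReal.coe_toReal (lt_top hx) (hbot x)).symm⟩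
  obtain ⟨q, hq⟩ : ∃ q : ℝ, f y = q := ⟨_, (EReal.coe_toReal (lt_top hy) (hbot y)).symm⟩
  have hxy : D (A.mulVec x) b + p = D (A.mulVec y) b + q := by
    have h := le_antisymm (hx y) (hy x)
    rw [hp, hq] at h
    exact_mod_cast h
  have hA : A.mulVec x = A.mulVec y := by
    by_contra hne
    have hlt := (hD b).2 (Set.mem_univ _) (Set.mem_univ _) hne
      (by norm_num : (0 : ℝ) < 1 / 2) (by norm_num : (0 : ℝ) < 1 / 2) (by norm_num)
    have hmid := hconv x y (1 / 2) (by norm_num) (by norm_num)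
    rw [show (1 : ℝ) - 1 / 2 = 1 / 2 by norm_num, hp, hq, ← EReal.coe_mul, ← EReal.coe_mul,
      ← EReal.coe_add] at hmid
    have hle := (hx ((1 / 2 : ℝ) • x + (1 / 2 : ℝ) • y)).trans (add_le_add_right hmid _)
    rw [hp, Matrix.mulVec_add, Matrix.mulVec_smul, Matrix.mulVec_smul, ← EReal.coe_add,
      ← EReal.coe_add, EReal.coe_le_coe_iff] at hle
    simp only [smul_eq_mul] at hlt
    linarith
  refine ⟨hA, ?_⟩
  rw [hA] at hxy
  rw [hp, hq, add_left_cancel hxy]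

end
end

section
/- Let Σ ∈ ℝ^{m×m} be symmetric positive definite and D(z, b) = (1/2)(z − b)ᵀΣ(z − b), let A ∈ ℝ^{m×n}, and let f : ℝ^n → ℝ ∪ {+∞} be convex piecewise linear. If for every b ∈ ℝ^m the set S(b) consists of exactly one point, then the map s : ℝ^m → ℝ^n sending b to the unique minimizer is continuous. -/
noncomputable section

/-- The minimizer of a jointly continuous family of convex functions on a closed convex set depends
continuously on the parameter, provided that it exists and is unique for every parameter. -/
theorem continuous_of_unique_minimizer {B E : Type*} [TopologicalSpace B] [NormedAddCommGroup E]
    [NormedSpace ℝ E] [ProperSpace E] {P : Set E} (hP : IsClosed P) {G : B → E → ℝ}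
    (hG : Continuous fun p : B × E => G p.1 p.2) (hconv : ∀ b, ConvexOn ℝ P (G b))
    {s : B → E} (hsP : ∀ b, s b ∈ P) (hmin : ∀ b, ∀ y ∈ P, G b (s b) ≤ G b y)
    (huniq : ∀ b, ∀ y ∈ P, G b y ≤ G b (s b) → y = s b) : Continuous s := by
  refine continuous_iff_continuousAt.2 fun b₀ => Metric.tendsto_nhds.2 fun ε hε => ?_
  have hK : IsCompact (Metric.sphere (s b₀) ε ∩ P) := (isCompact_sphere _ _).inter_right hP
  have hpos : ∀ x ∈ Metric.sphere (s b₀) ε ∩ P,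
      ∀ᶠ p : B × E in nhds b₀ ×ˢ nhds x, G p.1 (s b₀) < G p.1 p.2 := by
    rintro x ⟨hx, hxP⟩
    rw [← nhds_prod_eq]
    have hlt : G b₀ (s b₀) < G b₀ x := by
      by_contra! h
      have hxs := huniq b₀ x hxP h
      rw [hxs, Metric.mem_sphere, dist_self] at hx
      exact hε.ne hx
    have hl : Continuous fun p : B × E => G p.1 (s b₀) :=
      hG.comp (continuous_fst.prodMk continuous_const)
    exact hl.continuousAt.eventually_lt hG.continuousAt hlt
  filter_upwards [hK.eventually_forall_of_forall_eventually (P := fun b x => G b (s b₀) < G b x)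
    (by simpa only [nhds_prod_eq] using hpos)] with b hb
  by_contra! hfar
  have hd : 0 < dist (s b) (s b₀) := hε.trans_le hfar
  set t := ε / dist (s b) (s b₀) with ht
  have ht0 : 0 < t := div_pos hε hd
  have ht1 : t ≤ 1 := (div_le_one hd).2 hfar
  have hmem := (hconv b).1 (hsP b₀) (hsP b) (sub_nonneg.2 ht1) ht0.le (by ring)
  have hle := (hconv b).2 (hsP b₀) (hsP b) (sub_nonneg.2 ht1) ht0.le (by ring)
  have hsphere : (1 - t) • s b₀ + t • s b ∈ Metric.sphere (s b₀) ε := by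
    have hsub : (1 - t) • s b₀ + t • s b - s b₀ = t • (s b - s b₀) := by module
    rw [mem_sphere_iff_norm, hsub, norm_smul, Real.norm_of_nonneg ht0.le, ← dist_eq_norm, ht,
      div_mul_cancel₀ _ hd.ne']
  have hlt := hb _ ⟨hsphere, hmem⟩
  have hs := hmin b _ (hsP b₀)
  simp only [smul_eq_mul] at hle
  nlinarith [mul_le_mul_of_nonneg_left hs ht0.le]

theorem IsPolyhedron.isClosed {n : ℕ} {P : Set (Fin n → ℝ)} (hP : IsPolyhedron P) :
    IsClosed P := by
  obtain ⟨k, a, β, rfl⟩ := hP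
  simp only [Set.ofPred_forall]
  exact isClosed_iInter fun i => isClosed_le (by fun_prop) continuous_const

theorem IsPolyhedron.convex {n : ℕ} {P : Set (Fin n → ℝ)} (hP : IsPolyhedron P) :
    Convex ℝ P := by
  obtain ⟨k, a, β, rfl⟩ := hP
  simp only [Set.ofPred_forall]
  exact convex_iInter fun i =>
    convex_halfSpace_le (dotProductBilin ℝ ℝ (a i) : (Fin n → ℝ) →ₗ[ℝ] ℝ).isLinear (β i)

theorem convexOn_max_affine {n : ℕ} {P : Set (Fin n → ℝ)} (hP : Convex ℝ P) {ι : Type*}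
    {t : Finset ι} (ht : t.Nonempty) (v : ι → Fin n → ℝ) (w : ι → ℝ) :
    ConvexOn ℝ P fun x => t.sup' ht fun i => ∑ j, v i j * x j + w i := by
  refine ⟨hP, fun x _ y _ a c ha hc hac => Finset.sup'_le _ _ fun i hi => ?_⟩
  have hx := Finset.le_sup' (fun i => ∑ j, v i j * x j + w i) hi
  have hy := Finset.le_sup' (fun i => ∑ j, v i j * y j + w i) hi
  have hsum : ∑ j, v i j * (a • x + c • y) j = a * ∑ j, v i j * x j + c * ∑ j, v i j * y j := by
    simp only [Finset.mul_sum, ← Finset.sum_add_distrib, Pi.add_apply, Pi.smul_apply, smul_eq_mul]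
    exact Finset.sum_congr rfl fun j _ => by ring
  calc ∑ j, v i j * (a • x + c • y) j + w i
      = a * (∑ j, v i j * x j + w i) + c * (∑ j, v i j * y j + w i) := by
        rw [hsum]; linear_combination (-w i) * hac
    _ ≤ _ := add_le_add (mul_le_mul_of_nonneg_left hx ha) (mul_le_mul_of_nonneg_left hy hc)

theorem Matrix.PosSemidef.convexOn_dotProduct_mulVec {ι : Type*} [Fintype ι]
    {M : Matrix ι ι ℝ} (hM : M.PosSemidef) : ConvexOn ℝ Set.univ fun z => z ⬝ᵥ M.mulVec z := by
  refine ⟨convex_univ, fun x _ y _ a c ha hc hac => ?_⟩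
  have h := hM.dotProduct_mulVec_nonneg (x - y)
  obtain rfl : c = 1 - a := by linarith
  simp only [star_trivial, Matrix.mulVec_sub, Matrix.mulVec_add, Matrix.mulVec_smul,
    dotProduct_add, add_dotProduct, dotProduct_sub, sub_dotProduct, smul_dotProduct,
    dotProduct_smul, smul_eq_mul] at h ⊢
  nlinarith [mul_nonneg (mul_nonneg ha hc) h]

theorem mem_solSet_iff {m n : ℕ} {D : (Fin m → ℝ) → (Fin m → ℝ) → ℝ}
    {A : Matrix (Fin m) (Fin n) ℝ} {f : (Fin n → ℝ) → EReal} {P : Set (Fin n → ℝ)}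
    (hP : P.Nonempty) {g : (Fin n → ℝ) → ℝ} (hfg : ∀ x ∈ P, f x = g x) (hf : ∀ x ∉ P, f x = ⊤)
    {b : Fin m → ℝ} {x : Fin n → ℝ} :
    x ∈ solSet D A f b ↔
      x ∈ P ∧ ∀ y ∈ P, D (A.mulVec x) b + g x ≤ D (A.mulVec y) b + g y := by
  simp only [solSet, Set.mem_ofPred_eq]
  constructor
  · intro h
    have hx : x ∈ P := by
      by_contra hx
      obtain ⟨y, hy⟩ := hP
      have hxy := h y
      rw [hf x hx, hfg y hy, EReal.coe_add_top, ← EReal.coe_add, top_le_iff] at hxy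
      exact EReal.coe_ne_top _ hxy
    refine ⟨hx, fun y hy => ?_⟩
    have hxy := h y
    rw [hfg x hx, hfg y hy] at hxy
    exact_mod_cast hxy
  · rintro ⟨hx, h⟩ y
    by_cases hy : y ∈ P
    · rw [hfg x hx, hfg y hy]
      exact_mod_cast h y hy
    · rw [hf y hy, EReal.coe_add_top]
      exact le_top

/-- Uniqueness implies continuity of the solution map. -/
theorem uniqueness_implies_continuity {n m : ℕ}
    (Sig : Matrix (Fin m) (Fin m) ℝ) (hSym : Sig.IsSymm) (hPD : Sig.PosDef)
    (D : (Fin m → ℝ) → (Fin m → ℝ) → ℝ)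
    (hD : ∀ z b, D z b = (1 / 2) * ∑ i, (z i - b i) * ∑ j, Sig i j * (z j - b j))
    (A : Matrix (Fin m) (Fin n) ℝ) (f : (Fin n → ℝ) → EReal) (hf : IsCPWL f)
    (s : (Fin m → ℝ) → (Fin n → ℝ)) (hs : ∀ b, solSet D A f b = {s b}) :
    Continuous s := by
  obtain ⟨k, v, w, P, hP, hfP, hfT⟩ := hf
  rcases P.eq_empty_or_nonempty with rfl | hne
  · have hsub : Subsingleton (Fin n → ℝ) := by
      refine Set.subsingleton_univ_iff.1 ?_
      have huniv : solSet D A f 0 = Set.univ :=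
        Set.eq_univ_of_forall fun x y => by rw [hfT x (by simp), hfT y (by simp)]; simp
      rw [← huniv, hs]
      exact Set.subsingleton_singleton
    exact continuous_of_const fun _ _ => Subsingleton.elim _ _
  let g : (Fin n → ℝ) → ℝ :=
    fun x => Finset.univ.sup' Finset.univ_nonempty fun i => ∑ j, v i j * x j + w i
  have hmem (b x) := mem_solSet_iff (D := D) (A := A) (b := b) (x := x) hne hfP hfT
  have hsol (b) := (hmem b (s b)).1 (by rw [hs]; rfl)
  have hgc : Continuous g :=
    Continuous.finset_sup'_apply Finset.univ_nonempty fun i _ => by fun_prop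
  have hDq (z b) : D z b = (1 / 2 : ℝ) • ((z - b) ⬝ᵥ Sig.mulVec (z - b)) := hD z b
  refine continuous_of_unique_minimizer hP.isClosed
    (G := fun b x => D (A.mulVec x) b + g x) ?_ (fun b => ?_) (fun b => (hsol b).1)
    (fun b => (hsol b).2) fun b y hy hle => ?_
  · simp only [hDq]
    exact Continuous.add (by fun_prop) (hgc.comp continuous_snd)
  · refine ConvexOn.add ?_ (convexOn_max_affine hP.convex _ v w)
    simp only [hDq]
    refine ConvexOn.smul (by norm_num) ?_
    have h := hPD.posSemidef.convexOn_dotProduct_mulVec.comp_affineMap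
      (A.mulVecLin.toAffineMap - AffineMap.const ℝ _ b)
    exact h.subset (Set.subset_univ P) hP.convex
  · have hy' : y ∈ solSet D A f b := (hmem b y).2 ⟨hy, fun z hz => hle.trans ((hsol b).2 z hz)⟩
    rwa [hs, Set.mem_singleton_iff] at hy'

end
end

section
/- For a sign assignment u : E → {−1, 1}, the point z_u is an extreme point of the polytope P_TV if and only if the directed graph r_u is acyclic, i.e., the transitive closure of the relation r_u is irreflexive (there is no directed cycle). -/
noncomputable section

/-- The vector `d_{i,j} = e_i - e_j` associated to an oriented edge `p = (i, j)`. -/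
def dvec {N : ℕ} (p : Fin N × Fin N) : Fin N → ℝ :=
  fun i => (if i = p.1 then (1 : ℝ) else 0) - (if i = p.2 then (1 : ℝ) else 0)

/-- The point `z_u = ∑_{(i,j) ∈ E} u_{(i,j)} d_{i,j}` associated to a sign assignment `u`. -/
def zvec {N : ℕ} (E : Finset (Fin N × Fin N)) (u : Fin N × Fin N → ℝ) : Fin N → ℝ :=
  ∑ p ∈ E, u p • dvec p

/-- The polytope `P_TV`, the convex hull of all points `z_u` over sign assignments
`u : E → {-1, 1}`. -/
def PTV {N : ℕ} (E : Finset (Fin N × Fin N)) : Set (Fin N → ℝ) :=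
  convexHull ℝ
    {z | ∃ u : Fin N × Fin N → ℝ, (∀ p ∈ E, u p = 1 ∨ u p = -1) ∧ z = zvec E u}

/-- The map `w ↦ z_w` as a linear map on real edge weights. -/
def zvecLinear {N : ℕ} (E : Finset (Fin N × Fin N)) :
    (Fin N × Fin N → ℝ) →ₗ[ℝ] (Fin N → ℝ) where
  toFun := zvec E
  map_add' v w := by simp [zvec, add_smul, Finset.sum_add_distrib]
  map_smul' c w := by simp [zvec, Finset.smul_sum, mul_smul]

theorem zvecLinear_apply {N : ℕ} (E : Finset (Fin N × Fin N)) (w : Fin N × Fin N → ℝ) :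
    zvecLinear E w = zvec E w :=
  rfl

theorem zvec_congr {N : ℕ} {E : Finset (Fin N × Fin N)} {v w : Fin N × Fin N → ℝ}
    (h : ∀ p ∈ E, v p = w p) : zvec E v = zvec E w :=
  Finset.sum_congr rfl fun p hp => by rw [h p hp]

theorem zvec_single {N : ℕ} {E : Finset (Fin N × Fin N)} {p : Fin N × Fin N} (hp : p ∈ E)
    (c : ℝ) : zvec E (Pi.single p c) = c • dvec p := by
  unfold zvec
  rw [Finset.sum_eq_single_of_mem p hp]
  · simp
  · intro q _ hq
    simp [hq]

/-- The polytope is the projection of the cube `[-1, 1]^E`. -/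
theorem mem_PTV_iff {N : ℕ} {E : Finset (Fin N × Fin N)} {z : Fin N → ℝ} :
    z ∈ PTV E ↔ ∃ w : Fin N × Fin N → ℝ, (∀ p ∈ E, w p ∈ Set.Icc (-1) 1) ∧ zvec E w = z := by
  have key : {z | ∃ u : Fin N × Fin N → ℝ, (∀ p ∈ E, u p = 1 ∨ u p = -1) ∧ z = zvec E u} =
      zvecLinear E '' ((E : Set (Fin N × Fin N)).pi fun _ => {1, -1}) := by
    ext z
    simp [zvecLinear_apply, Set.mem_pi, eq_comm]
  have hseg : convexHull ℝ ({1, -1} : Set ℝ) = Set.Icc (-1) 1 := by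
    rw [convexHull_pair, segment_symm, segment_eq_Icc (by norm_num)]
  rw [PTV, key, ← LinearMap.image_convexHull, convexHull_pi, hseg]
  simp [zvecLinear_apply, Set.mem_pi]

theorem sum_mul_dvec {N : ℕ} (h : Fin N → ℝ) (p : Fin N × Fin N) :
    ∑ i, h i * dvec p i = h p.1 - h p.2 := by
  simp [dvec, mul_sub, Finset.sum_sub_distrib]

theorem sum_mul_zvec {N : ℕ} (E : Finset (Fin N × Fin N)) (h : Fin N → ℝ)
    (w : Fin N × Fin N → ℝ) :
    ∑ i, h i * zvec E w i = ∑ p ∈ E, w p * (h p.1 - h p.2) := by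
  simp only [zvec, Finset.sum_apply, Pi.smul_apply, smul_eq_mul, Finset.mul_sum]
  rw [Finset.sum_comm]
  refine Finset.sum_congr rfl fun p _ => ?_
  rw [← sum_mul_dvec, Finset.mul_sum]
  exact Finset.sum_congr rfl fun i _ => by ring

/-- A finite acyclic relation has a strictly monotone real-valued potential. -/
theorem exists_potential_of_acyclic {α : Type*} [Finite α] {r : α → α → Prop}
    (hac : ∀ a, ¬ Relation.TransGen r a a) : ∃ h : α → ℝ, ∀ a b, r a b → h a < h b := by
  refine ⟨fun a => (Set.ncard {c | Relation.TransGen r c a} : ℝ), fun a b hab => ?_⟩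
  refine Nat.cast_lt.mpr (Set.ncard_lt_ncard ?_ (Set.toFinite _))
  refine (Set.ssubset_iff_of_subset fun c hc => Relation.TransGen.tail hc hab).mpr ?_
  exact ⟨a, Relation.TransGen.single hab, hac a⟩

/-- If a linear functional is positive on every `u_p d_p`, then `z_u` is an extreme point. -/
theorem zvec_mem_extremePoints_of_potential {N : ℕ} {E : Finset (Fin N × Fin N)}
    {u : Fin N × Fin N → ℝ} (hu : ∀ p ∈ E, u p = 1 ∨ u p = -1) {h : Fin N → ℝ}
    (hpos : ∀ p ∈ E, 0 < u p * (h p.1 - h p.2)) :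
    zvec E u ∈ (PTV E).extremePoints ℝ := by
  have hcube : ∀ p ∈ E, u p ∈ Set.Icc (-1 : ℝ) 1 := fun p hp => by
    rcases hu p hp with h | h <;> rw [h] <;> norm_num
  have hterm : ∀ w : Fin N × Fin N → ℝ, (∀ p ∈ E, w p ∈ Set.Icc (-1 : ℝ) 1) →
      ∀ p ∈ E, w p * (h p.1 - h p.2) ≤ u p * (h p.1 - h p.2) := fun w hw p hp => by
    have h0 := hpos p hp
    obtain ⟨h1, h2⟩ := hw p hp
    rcases hu p hp with h | h <;> rw [h] at h0 ⊢ <;> nlinarith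
  refine ⟨mem_PTV_iff.mpr ⟨u, hcube, rfl⟩, ?_⟩
  intro x hx y hy hz
  obtain ⟨v, hv, rfl⟩ := mem_PTV_iff.mp hx
  obtain ⟨w, hw, rfl⟩ := mem_PTV_iff.mp hy
  obtain ⟨a, b, ha, hb, hab, hz⟩ := hz
  have hsum : a * ∑ p ∈ E, v p * (h p.1 - h p.2) + b * ∑ p ∈ E, w p * (h p.1 - h p.2) =
      ∑ p ∈ E, u p * (h p.1 - h p.2) := by
    simp only [← sum_mul_zvec, ← hz, Finset.mul_sum, ← Finset.sum_add_distrib]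
    exact Finset.sum_congr rfl fun i _ => by simp; ring
  have hle := Finset.sum_le_sum (hterm v hv)
  have hle' := Finset.sum_le_sum (hterm w hw)
  have heq : ∑ p ∈ E, v p * (h p.1 - h p.2) = ∑ p ∈ E, u p * (h p.1 - h p.2) := by
    obtain rfl : b = 1 - a := by linarith
    refine le_antisymm hle ?_
    by_contra! hlt
    nlinarith [mul_lt_mul_of_pos_left hlt ha, mul_le_mul_of_nonneg_left hle' hb.le]
  refine zvec_congr fun p hp => ?_
  have hne : h p.1 - h p.2 ≠ 0 := fun h0 => by simpa [h0] using hpos p hp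
  exact mul_right_cancel₀ hne ((Finset.sum_eq_sum_iff_of_le (hterm v hv)).mp heq p hp)

/-- A directed walk from `a` to `b` is a nonzero nonnegative flow with divergence `e_b - e_a`. -/
theorem exists_flow_of_transGen {N : ℕ} {E : Finset (Fin N × Fin N)}
    {u : Fin N × Fin N → ℝ} {r : Fin N → Fin N → Prop}
    (hr : ∀ a b, r a b → ∃ p ∈ E, u p • dvec p = dvec (b, a))
    {a b : Fin N} (hab : Relation.TransGen r a b) :
    ∃ c : Fin N × Fin N → ℝ, (∀ p, 0 ≤ c p) ∧ (∃ p ∈ E, 0 < c p) ∧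
      zvec E (c * u) = dvec (b, a) := by
  have hstep : ∀ {a b}, r a b → ∃ c : Fin N × Fin N → ℝ, (∀ p, 0 ≤ c p) ∧
      (∃ p ∈ E, 0 < c p) ∧ zvec E (c * u) = dvec (b, a) := by
    intro a b h
    obtain ⟨p, hp, hpd⟩ := hr a b h
    have h0 : (0 : Fin N × Fin N → ℝ) ≤ Pi.single p 1 := Pi.single_nonneg.mpr zero_le_one
    refine ⟨Pi.single p 1, h0, ⟨p, hp, by simp⟩, ?_⟩
    rw [← Pi.single_mul_left, one_mul, zvec_single hp, hpd]
  induction hab with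
  | single h => exact hstep h
  | tail _ h ih =>
    obtain ⟨c, hc, ⟨p, hp, hcp⟩, hcz⟩ := ih
    obtain ⟨c', hc', -, hcz'⟩ := hstep h
    refine ⟨c + c', fun q => add_nonneg (hc q) (hc' q),
      ⟨p, hp, add_pos_of_pos_of_nonneg hcp (hc' p)⟩, ?_⟩
    have hadd := (zvecLinear E).map_add (c * u) (c' * u)
    change zvec E _ = zvec E _ + zvec E _ at hadd
    rw [add_mul, hadd, hcz, hcz']
    ext i
    simp [dvec]

/-- If the signed edge vectors carry a nonzero nonnegative circulation, then `z_u` is not an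
extreme point. -/
theorem zvec_notMem_extremePoints_of_circulation {N : ℕ} {E : Finset (Fin N × Fin N)}
    (hE : ∀ p ∈ E, p.1 ≠ p.2) {u : Fin N × Fin N → ℝ} (hu : ∀ p ∈ E, u p = 1 ∨ u p = -1)
    {c : Fin N × Fin N → ℝ} (hc : ∀ p, 0 ≤ c p) {q : Fin N × Fin N} (hq : q ∈ E)
    (hcq : 0 < c q) (hcirc : zvec E (c * u) = 0) :
    zvec E u ∉ (PTV E).extremePoints ℝ := by
  intro hext
  have hS : 0 < ∑ p, c p := Finset.sum_pos' (fun p _ => hc p) ⟨q, Finset.mem_univ q, hcq⟩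
  have hle : ∀ p, c p / ∑ p, c p ≤ 1 := fun p =>
    (div_le_one hS).mpr (Finset.single_le_sum (fun p _ => hc p) (Finset.mem_univ p))
  have hnn : ∀ p, 0 ≤ c p / ∑ p, c p := fun p => div_nonneg (hc p) hS.le
  have hδ : 0 < c q / ∑ p, c p := div_pos hcq hS
  set S := ∑ p, c p
  have hmem : ∀ s : ℝ, s = 1 ∨ s = -1 → zvec E u + (s * (c q / S)) • dvec q ∈ PTV E := by
    intro s hs
    refine mem_PTV_iff.mpr ⟨u - S⁻¹ • (c * u) + Pi.single q (s * (c q / S)), ?_, ?_⟩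
    · intro p hp
      have hval : (u - S⁻¹ • (c * u)) p = (1 - c p / S) * u p := by
        simp
        ring
      rw [Pi.add_apply, hval, Set.mem_Icc]
      have h1 := hle p
      have h2 := hnn p
      by_cases hpq : p = q
      · subst hpq
        rw [Pi.single_eq_same]
        rcases hu p hp with h | h <;> rcases hs with rfl | rfl <;> rw [h] <;>
          constructor <;> linarith
      · rw [Pi.single_eq_of_ne hpq]
        rcases hu p hp with h | h <;> rw [h] <;> constructor <;> linarith
    · have hlin : zvecLinear E (u - S⁻¹ • (c * u) + Pi.single q (s * (c q / S))) =
          zvecLinear E u - S⁻¹ • zvecLinear E (c * u) +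
            zvecLinear E (Pi.single q (s * (c q / S))) := by
        simp only [map_add, map_sub, map_smul]
      change zvec E _ = zvec E _ - _ • zvec E _ + zvec E _ at hlin
      rw [hlin, hcirc, zvec_single hq, smul_zero, sub_zero]
  have heq := hext.2 (hmem 1 (Or.inl rfl)) (hmem (-1) (Or.inr rfl))
    ⟨1 / 2, 1 / 2, by norm_num, by norm_num, by norm_num, by module⟩
  have hzero := congrFun (add_eq_left.mp heq) q.1
  simp [dvec, hE q hq] at hzero
  rcases hzero with h | h
  · exact hcq.ne' h
  · exact hS.ne' h

/-- `z_u` is an extreme point of `P_TV` if and only if the associated directed graph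
is acyclic. -/
theorem zvec_extremePoint_iff_acyclic {N : ℕ} (hN : 1 ≤ N)
    (E : Finset (Fin N × Fin N)) (hE1 : ∀ p ∈ E, p.1 ≠ p.2)
    (hE2 : ∀ p ∈ E, (p.2, p.1) ∉ E)
    (u : Fin N × Fin N → ℝ) (hu : ∀ p ∈ E, u p = 1 ∨ u p = -1)
    (r : Fin N → Fin N → Prop)
    (hr : ∀ a b : Fin N, r a b ↔
      (((b, a) ∈ E ∧ u (b, a) = 1) ∨ ((a, b) ∈ E ∧ u (a, b) = -1))) :
    zvec E u ∈ (PTV E).extremePoints ℝ ↔ ∀ a : Fin N, ¬ Relation.TransGen r a a := by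
  constructor
  · intro hext a ha
    obtain ⟨c, hc, ⟨q, hq, hcq⟩, hcz⟩ := exists_flow_of_transGen (E := E) (u := u) (r := r)
      (fun a b hab => by
        rcases (hr a b).mp hab with ⟨hp, h⟩ | ⟨hp, h⟩
        · exact ⟨_, hp, by rw [h, one_smul]⟩
        · refine ⟨_, hp, ?_⟩
          rw [h]
          ext i
          simp [dvec]) ha
    refine zvec_notMem_extremePoints_of_circulation hE1 hu hc hq hcq ?_ hext
    rw [hcz]
    ext i
    simp [dvec]
  · intro hac
    obtain ⟨h, hh⟩ := exists_potential_of_acyclic hac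
    refine zvec_mem_extremePoints_of_potential hu (h := h) fun p hp => ?_
    rcases hu p hp with hup | hup
    · have := hh p.2 p.1 ((hr _ _).mpr (Or.inl ⟨hp, hup⟩))
      rw [hup]
      linarith
    · have := hh p.1 p.2 ((hr _ _).mpr (Or.inr ⟨hp, hup⟩))
      rw [hup]
      linarith

end
end

section
/- Let C = {q ∈ ℝ^N | q_i ≤ 0 for all i} and consider the Minkowski sum P_TV + C = {p + q | p ∈ P_TV, q ∈ C}. Then the set of extreme points of P_TV + C equals the set of extreme points of P_TV. -/
noncomputable section

theorem sum_dvec {N : ℕ} (p : Fin N × Fin N) : ∑ i, dvec p i = 0 := by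
  simp [dvec]

theorem sum_zvec {N : ℕ} (E : Finset (Fin N × Fin N)) (u : Fin N × Fin N → ℝ) :
    ∑ i, zvec E u i = 0 := by
  simp only [zvec, Finset.sum_apply, Pi.smul_apply, smul_eq_mul]
  rw [Finset.sum_comm]
  simp [← Finset.mul_sum, sum_dvec]

/-- `P_TV` lies in the hyperplane of vectors with coordinate sum zero. -/
theorem sum_eq_zero_of_mem_PTV {N : ℕ} {E : Finset (Fin N × Fin N)} {x : Fin N → ℝ}
    (hx : x ∈ PTV E) : ∑ i, x i = 0 := by
  have hconv : Convex ℝ {w : Fin N → ℝ | ∑ i, w i = 0} :=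
    convex_hyperplane
      ⟨fun v w => by simp [Finset.sum_add_distrib], fun c v => by simp [Finset.mul_sum]⟩ 0
  refine convexHull_min ?_ hconv hx
  rintro _ ⟨u, -, rfl⟩
  exact sum_zvec E u

/-- `P_TV` is the face of `P_TV + C` on which the coordinate sum attains its maximum, zero. -/
theorem isExtreme_PTV_add_cone {N : ℕ} (E : Finset (Fin N × Fin N)) :
    IsExtreme ℝ {x : Fin N → ℝ | ∃ p ∈ PTV E, ∃ q : Fin N → ℝ,
      (∀ i, q i ≤ 0) ∧ x = p + q} (PTV E) := by
  refine ⟨fun p hp => ⟨p, hp, 0, fun _ => le_rfl, (add_zero p).symm⟩, ?_⟩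
  rintro _ ⟨p, hp, q, hq, rfl⟩ _ ⟨p', hp', q', hq', rfl⟩ _ hz ⟨a, b, ha, hb, -, rfl⟩
  have hsum := sum_eq_zero_of_mem_PTV hz
  simp only [Pi.add_apply, Pi.smul_apply, smul_eq_mul, Finset.sum_add_distrib,
    ← Finset.mul_sum, sum_eq_zero_of_mem_PTV hp, sum_eq_zero_of_mem_PTV hp', zero_add] at hsum
  have hq_sum : ∑ i, q i ≤ 0 := Finset.sum_nonpos fun i _ => hq i
  have hq_sum' : ∑ i, q' i ≤ 0 := Finset.sum_nonpos fun i _ => hq' i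
  have hq_zero : ∑ i, q i = 0 := by
    refine le_antisymm hq_sum ?_
    nlinarith [mul_nonpos_of_nonneg_of_nonpos hb.le hq_sum']
  have hq_eq : q = 0 := funext fun i =>
    (Finset.sum_eq_zero_iff_of_nonpos fun i _ => hq i).1 hq_zero i (Finset.mem_univ i)
  simpa [hq_eq] using hp

/-- Adding the nonpositive orthant to `P_TV` does not change the extreme points. -/
theorem extremePoints_PTV_add_cone {N : ℕ} (hN : 1 ≤ N)
    (E : Finset (Fin N × Fin N)) (hE1 : ∀ p ∈ E, p.1 ≠ p.2)
    (hE2 : ∀ p ∈ E, (p.2, p.1) ∉ E) :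
    ({x : Fin N → ℝ | ∃ p ∈ PTV E, ∃ q : Fin N → ℝ,
        (∀ i, q i ≤ 0) ∧ x = p + q}).extremePoints ℝ = (PTV E).extremePoints ℝ := by
  rw [(isExtreme_PTV_add_cone E).extremePoints_eq, eq_comm, Set.inter_eq_right]
  rintro _ ⟨⟨p, hp, q, hq, rfl⟩, hext⟩
  have hmid : p + q ∈ openSegment ℝ p (p + (q + q)) :=
    ⟨1 / 2, 1 / 2, by norm_num, by norm_num, by norm_num, by module⟩
  have hp_eq := hext ⟨p, hp, 0, fun _ => le_rfl, (add_zero p).symm⟩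
    ⟨p, hp, q + q, fun i => add_nonpos (hq i) (hq i), rfl⟩ hmid
  exact hp_eq ▸ hp

end
end
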